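/- Let F = F̆(α_1,…,α_t) be a fence, let i ∈ {1,…,t} with α_i ≥ 2, let v be the valley of S_i (if it exists) and p the peak of S_i (if it exists). Then for each j ∈ {1,…,β_i}, as functions on J(F): α_i·χ̂_{(i,j)} − j·χ̂_p − (α_i − j)·χ̂_v = [S_i has no valley]·(α_i − j) − (α_i − j)·Σ_{u : s_{(i,1)} ⊴ u ⊴ s_{(i,j)}} #[s_{(i,1)},u]·T_u − j·Σ_{u : s_{(i,j)} ◁ u ⊴ s_{(i,β_i)}} #[u,s_{(i,β_i)}]·T_u, where [S_i has no valley] is 1 if S_i has no valley and 0 otherwise, the sums range over elements u of F in the indicated order intervals, and #[a,b] denotes the number of elements r of F with a ⊴ r ⊴ b. -/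

import Mathlib

open scoped Classical

namespace Fence

/-- partial sums: `m α i = α 0 + ⋯ + α (i-1)` (the paper's `m_i`). -/
def m (α : ℕ → ℕ) (i : ℕ) : ℕ := ∑ k ∈ Finset.range i, α k

/-- the number `n` of elements of the fence `F̆(α)`. -/
def nn (t : ℕ) (α : ℕ → ℕ) : ℕ := m α t - 1

/-- vertex type: index `0` is a dummy (used as sentinel for nonexistent elements);
the fence elements are the indices `1,…,nn t α`. -/
abbrev V (t : ℕ) (α : ℕ → ℕ) := Fin (nn t α + 1)

/-- the element `x_j` (1-based). -/
def xel (t : ℕ) (α : ℕ → ℕ) (j : ℕ) : V t α :=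
  ⟨j % (nn t α + 1), Nat.mod_lt _ (Nat.succ_pos _)⟩

/-- `p` is an actual element of the fence (not the dummy `0`). -/
def Elem (t : ℕ) (α : ℕ → ℕ) (p : V t α) : Prop := 1 ≤ (p : ℕ)

/-- the conditions on `(t, α)` for `F̆(α)` to be a fence. -/
def IsFence (t : ℕ) (α : ℕ → ℕ) : Prop :=
  2 ≤ t ∧ (∀ i < t, 1 ≤ α i) ∧ 2 ≤ α 0 ∧ 2 ≤ α (t - 1)

/-- the covering relation of the fence: `Cov t α a b` means `a ⋖ b`. -/
def Cov (t : ℕ) (α : ℕ → ℕ) (a b : V t α) : Prop :=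
  ∃ i < t, ((i % 2 = 0 ∧ (b : ℕ) = (a : ℕ) + 1) ∨ (i % 2 = 1 ∧ (a : ℕ) = (b : ℕ) + 1)) ∧
    m α i ≤ min (a : ℕ) (b : ℕ) ∧ min (a : ℕ) (b : ℕ) < m α (i + 1) ∧
    1 ≤ min (a : ℕ) (b : ℕ) ∧ max (a : ℕ) (b : ℕ) ≤ nn t α

/-- the order of the fence: reflexive–transitive closure of the covering relation. -/
def Le (t : ℕ) (α : ℕ → ℕ) : V t α → V t α → Prop := Relation.ReflTransGen (Cov t α)

/-- order ideals of the fence (as sets of actual elements, downward closed). -/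
def IsIdeal (t : ℕ) (α : ℕ → ℕ) (I : Set (V t α)) : Prop :=
  (∀ p ∈ I, Elem t α p) ∧ ∀ a b : V t α, Le t α a b → b ∈ I → a ∈ I

/-- `J t α` is the set of order ideals of the fence. -/
abbrev J (t : ℕ) (α : ℕ → ℕ) := {I : Set (V t α) // IsIdeal t α I}

/-- `p` is a maximal element of the set `I`. -/
def MaxIn (t : ℕ) (α : ℕ → ℕ) (I : Set (V t α)) (p : V t α) : Prop :=
  p ∈ I ∧ ∀ q ∈ I, Le t α p q → q = p

/-- `p` is a minimal element of the complement of `I` (among actual elements). -/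
def MinOut (t : ℕ) (α : ℕ → ℕ) (I : Set (V t α)) (p : V t α) : Prop :=
  Elem t α p ∧ p ∉ I ∧ ∀ q : V t α, Elem t α q → q ∉ I → Le t α q p → q = p

/-- the order-ideal indicator function `χ̂_p`. -/
noncomputable def chiHat (t : ℕ) (α : ℕ → ℕ) (p : V t α) (I : J t α) : ℝ :=
  if p ∈ I.1 then 1 else 0

/-- the antichain indicator function `χ_p`. -/
noncomputable def chi (t : ℕ) (α : ℕ → ℕ) (p : V t α) (I : J t α) : ℝ :=
  if MaxIn t α I.1 p then 1 else 0

/-- the toggleability statistic `T_p`. -/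
noncomputable def Tg (t : ℕ) (α : ℕ → ℕ) (p : V t α) (I : J t α) : ℝ :=
  if MinOut t α I.1 p then 1 else if MaxIn t α I.1 p then -1 else 0

/-- the antichain toggleability statistic `T_A`. -/
noncomputable def TA (t : ℕ) (α : ℕ → ℕ) (A : Set (V t α)) (I : J t α) : ℝ :=
  if ∀ p ∈ A, MinOut t α I.1 p then 1 else if ∀ p ∈ A, MaxIn t α I.1 p then -1 else 0

/-- `#[a,b]`: the number of elements `r` with `a ⊴ r ⊴ b`. -/
noncomputable def icard (t : ℕ) (α : ℕ → ℕ) (a b : V t α) : ℕ :=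
  Set.ncard {r : V t α | Elem t α r ∧ Le t α a r ∧ Le t α r b}

/-- the span of the toggleability statistics `{T_p : p ∈ F}`. -/
noncomputable def ToggSpan (t : ℕ) (α : ℕ → ℕ) : Submodule ℝ (J t α → ℝ) :=
  Submodule.span ℝ {f | ∃ p : V t α, Elem t α p ∧ f = Tg t α p}

/-- `f ≡ g`: `f - g` is an `ℝ`-linear combination of toggleability statistics. -/
def Equiv' (t : ℕ) (α : ℕ → ℕ) (f g : J t α → ℝ) : Prop := f - g ∈ ToggSpan t α

/-- statistics of the form `const + linear combination of toggleability statistics`. -/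
noncomputable def ConstPlusTogg (t : ℕ) (α : ℕ → ℕ) : Submodule ℝ (J t α → ℝ) :=
  ToggSpan t α ⊔ Submodule.span ℝ {fun _ : J t α => (1 : ℝ)}

/-- the span of the antichain indicator functions `{χ_p : p ∈ F}`. -/
noncomputable def chiSpan (t : ℕ) (α : ℕ → ℕ) : Submodule ℝ (J t α → ℝ) :=
  Submodule.span ℝ {f | ∃ p : V t α, Elem t α p ∧ f = chi t α p}

/-- the span of the order-ideal indicator functions `{χ̂_p : p ∈ F}`. -/
noncomputable def chiHatSpan (t : ℕ) (α : ℕ → ℕ) : Submodule ℝ (J t α → ℝ) :=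
  Submodule.span ℝ {f | ∃ p : V t α, Elem t α p ∧ f = chiHat t α p}

/-- the antichain toggleability space `A_T(F)`. -/
noncomputable def AT (t : ℕ) (α : ℕ → ℕ) : Submodule ℝ (J t α → ℝ) :=
  chiSpan t α ⊓ ConstPlusTogg t α

/-- the order ideal toggleability space `I_T(F)`. -/
noncomputable def IT (t : ℕ) (α : ℕ → ℕ) : Submodule ℝ (J t α → ℝ) :=
  chiHatSpan t α ⊓ ConstPlusTogg t α

/-- the shared element `s_i = x_{m_i}` (for `1 ≤ i ≤ t-1`); the sentinels `i = 0` and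
`i = t` give the dummy vertex `0`, so statistics indexed by them vanish. -/
def sElx (t : ℕ) (α : ℕ → ℕ) (i : ℕ) : V t α := xel t α (m α i)

/-- 1-based index of the unshared element `s_{(i,j)}` (the `j`-th smallest unshared
element of the segment `S_i`, in the order of the fence). -/
def uEl (α : ℕ → ℕ) (i j : ℕ) : ℕ :=
  if (i - 1) % 2 = 0 then m α (i - 1) + j else m α i - j

def uElx (t : ℕ) (α : ℕ → ℕ) (i j : ℕ) : V t α := xel t α (uEl α i j)

/-- 1-based index of the peak of segment `S_i` (sentinel `0` if it does not exist). -/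
def peakN (t : ℕ) (α : ℕ → ℕ) (i : ℕ) : ℕ :=
  if i % 2 = 1 then (if i + 1 ≤ t then m α i else 0) else m α (i - 1)

/-- 1-based index of the valley of segment `S_i` (sentinel `0` if it does not exist). -/
def valleyN (t : ℕ) (α : ℕ → ℕ) (i : ℕ) : ℕ :=
  if i % 2 = 1 then (if 2 ≤ i then m α (i - 1) else 0) else (if i + 1 ≤ t then m α i else 0)

def peakx (t : ℕ) (α : ℕ → ℕ) (i : ℕ) : V t α := xel t α (peakN t α i)
def valleyx (t : ℕ) (α : ℕ → ℕ) (i : ℕ) : V t α := xel t α (valleyN t α i)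

/-- segment `S_i` has a peak. -/
def HasPeak (t i : ℕ) : Prop := i % 2 = 0 ∨ i + 1 ≤ t

/-- segment `S_i` has a valley. -/
def HasValley (t i : ℕ) : Prop := (i % 2 = 1 ∧ 2 ≤ i) ∨ (i % 2 = 0 ∧ i + 1 ≤ t)

/-- `p` is a shared element of the fence. -/
def IsSharedElem (t : ℕ) (α : ℕ → ℕ) (p : V t α) : Prop :=
  ∃ i, 1 ≤ i ∧ i + 1 ≤ t ∧ p = sElx t α i

/-- `p` is a peak of the fence. -/
def IsPeakElem (t : ℕ) (α : ℕ → ℕ) (p : V t α) : Prop :=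
  ∃ i, 1 ≤ i ∧ i + 1 ≤ t ∧ i % 2 = 1 ∧ p = sElx t α i

/-- span of the antichain indicators of the shared elements. -/
noncomputable def chiSharedSpan (t : ℕ) (α : ℕ → ℕ) : Submodule ℝ (J t α → ℝ) :=
  Submodule.span ℝ {f | ∃ i, 1 ≤ i ∧ i + 1 ≤ t ∧ f = chi t α (sElx t α i)}

/-- span of the order-ideal indicators of the shared elements. -/
noncomputable def chiHatSharedSpan (t : ℕ) (α : ℕ → ℕ) : Submodule ℝ (J t α → ℝ) :=
  Submodule.span ℝ {f | ∃ i, 1 ≤ i ∧ i + 1 ≤ t ∧ f = chiHat t α (sElx t α i)}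

theorem cov_elem {t : ℕ} {α : ℕ → ℕ} {a b : V t α} (h : Cov t α a b) :
    Elem t α a ∧ Elem t α b := by
  obtain ⟨i, hi, hd, h1, h2, h3, h4⟩ := h
  constructor <;> (simp only [Elem]; omega)

theorem le_elem {t : ℕ} {α : ℕ → ℕ} {a b : V t α} (h : Le t α a b) (hb : Elem t α b) :
    Elem t α a := by
  induction h using Relation.ReflTransGen.head_induction_on with
  | refl => exact hb
  | head hc _ _ => exact (cov_elem hc).1

/-- rowmotion: `ρ(I)` is the order ideal generated by the minimal elements of the
complement of `I`. -/
noncomputable def rho (t : ℕ) (α : ℕ → ℕ) (I : J t α) : J t α :=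
  ⟨{q | ∃ p : V t α, MinOut t α I.1 p ∧ Le t α q p}, by
    constructor
    · rintro q ⟨p, hp, hle⟩
      exact le_elem hle hp.1
    · rintro a b hab ⟨p, hp, hle⟩
      exact ⟨p, hp, Relation.ReflTransGen.trans hab hle⟩⟩

/-- the (forward) orbit of `x` under `ρ`. -/
def orbit {X : Type*} (ρ : X → X) (x : X) : Set X := {y | ∃ k : ℕ, ρ^[k] x = y}

/-- `f` is `c`-mesic under `ρ`: the sum of `f` over each orbit is `c` times
the orbit size. -/
def IsMesic {X : Type*} (ρ : X → X) (f : X → ℝ) (c : ℝ) : Prop :=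
  ∀ x : X, ∑ᶠ y ∈ orbit ρ x, f y = (orbit ρ x).ncard * c


theorem m_mono (α : ℕ → ℕ) {a b : ℕ} (h : a ≤ b) : m α a ≤ m α b := by
  unfold m
  exact Finset.sum_le_sum_of_subset (Finset.range_mono h)

theorem m_succ (α : ℕ → ℕ) (a : ℕ) : m α (a + 1) = m α a + α a := by
  unfold m
  exact Finset.sum_range_succ _ _

theorem minOut_iff {t : ℕ} {α : ℕ → ℕ} (I : J t α) (p : V t α) :
    MinOut t α I.1 p ↔ Elem t α p ∧ p ∉ I.1 ∧ ∀ q, Cov t α q p → q ∈ I.1 := by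
  constructor
  · rintro ⟨h1, h2, h3⟩
    refine ⟨h1, h2, fun q hq => ?_⟩
    by_contra hn
    have := h3 q (cov_elem hq).1 hn (Relation.ReflTransGen.single hq)
    subst this
    obtain ⟨i, -, h, -⟩ := hq
    omega
  · rintro ⟨h1, h2, h3⟩
    refine ⟨h1, h2, fun q _ hqI hq => ?_⟩
    rcases Relation.ReflTransGen.cases_tail hq with h | ⟨r, hr, hc⟩
    · exact h.symm
    · exact absurd (I.2.2 q r hr (h3 r hc)) hqI

theorem maxIn_iff {t : ℕ} {α : ℕ → ℕ} (I : J t α) (p : V t α) :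
    MaxIn t α I.1 p ↔ p ∈ I.1 ∧ ∀ q, Cov t α p q → q ∉ I.1 := by
  constructor
  · rintro ⟨h2, h3⟩
    refine ⟨h2, fun q hq hn => ?_⟩
    have := h3 q hn (Relation.ReflTransGen.single hq)
    subst this
    obtain ⟨i, -, h, -⟩ := hq
    omega
  · rintro ⟨h2, h3⟩
    refine ⟨h2, fun q hqI hq => ?_⟩
    rcases Relation.ReflTransGen.cases_head hq with h | ⟨r, hc, hr⟩
    · exact h.symm
    · exact absurd (I.2.2 r q hr hqI) (h3 r hc)

/-- numerical facts about the segment with (0-based) index `s`. -/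
theorem seg_facts {t : ℕ} {α : ℕ → ℕ} (hF : IsFence t α) {s : ℕ} (hs : s < t) :
    nn t α + 1 = m α t ∧ m α s + α s ≤ m α t ∧ (s + 1 = t ↔ m α s + α s = m α t) ∧
    (s = 0 ↔ m α s = 0) := by
  obtain ⟨h2, hp, h0, hl⟩ := hF
  have h1 : m α 1 = α 0 := by simp [m]
  have hm0 : m α 0 = 0 := by simp [m]
  have a1 := m_mono α (show 1 ≤ t by omega)
  have a2 := m_mono α (show s + 1 ≤ t by omega)
  have a3 := m_succ α s
  refine ⟨by unfold nn; omega, by omega, ⟨?_, ?_⟩, ⟨?_, ?_⟩⟩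
  · rintro rfl; omega
  · intro h
    by_contra hne
    have b1 := m_mono α (show s + 1 + 1 ≤ t by omega)
    have b2 := m_succ α (s + 1)
    have b3 := hp (s + 1) (by omega)
    omega
  · rintro rfl; exact hm0
  · intro h
    by_contra hne
    have := m_mono α (show 1 ≤ s by omega)
    omega

theorem uElx_val {t : ℕ} {α : ℕ → ℕ} (hF : IsFence t α) {s : ℕ} (hs : s < t)
    {k : ℕ} (hk : k ≤ α s) :
    ((uElx t α (s + 1) k : V t α) : ℕ) =
      if s % 2 = 0 then (if k = α s ∧ s + 1 = t then 0 else m α s + k)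
      else (if k = 0 ∧ s + 1 = t then 0 else m α s + α s - k) := by
  obtain ⟨f1, f2, f3, f4⟩ := seg_facts hF hs
  have a3 := m_succ α s
  simp only [uElx, xel, uEl, Nat.add_sub_cancel, a3, f1]
  split_ifs with h1 h2 h2
  · rw [h2.1, f3.1 h2.2, Nat.mod_self]
  · apply Nat.mod_eq_of_lt
    by_cases h : k = α s
    · have : ¬ (s + 1 = t) := fun h' => h2 ⟨h, h'⟩
      rw [f3] at this; omega
    · omega
  · rw [h2.1, Nat.sub_zero, f3.1 h2.2, Nat.mod_self]
  · apply Nat.mod_eq_of_lt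
    have hs0 : s ≠ 0 := by rintro rfl; simp at h1
    have : m α s ≠ 0 := fun h => hs0 (f4.2 h)
    by_cases h : k = 0
    · have : ¬ (s + 1 = t) := fun h' => h2 ⟨h, h'⟩
      rw [f3] at this; omega
    · omega

theorem peakx_eq {t : ℕ} {α : ℕ → ℕ} (hF : IsFence t α) {s : ℕ} (hs : s < t) :
    peakx t α (s + 1) = uElx t α (s + 1) (α s) := by
  obtain ⟨f1, f2, f3, f4⟩ := seg_facts hF hs
  have a3 := m_succ α s
  simp only [peakx, uElx, peakN, uEl, Nat.add_sub_cancel]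
  by_cases h : s % 2 = 0
  · rw [if_pos (by omega), if_pos h]
    by_cases h' : s + 1 + 1 ≤ t
    · rw [if_pos h', a3]
    · rw [if_neg h']
      have := f3.1 (by omega)
      simp [xel, this, f1]
  · rw [if_neg (by omega), if_neg h, a3, Nat.add_sub_cancel]

theorem valleyx_eq {t : ℕ} {α : ℕ → ℕ} (hF : IsFence t α) {s : ℕ} (hs : s < t) :
    valleyx t α (s + 1) = uElx t α (s + 1) 0 := by
  obtain ⟨f1, f2, f3, f4⟩ := seg_facts hF hs
  have a3 := m_succ α s
  simp only [valleyx, uElx, valleyN, uEl, Nat.add_sub_cancel]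
  by_cases h : s % 2 = 0
  · rw [if_pos (by omega), if_pos h]
    by_cases h' : 2 ≤ s + 1
    · rw [if_pos h', Nat.add_zero]
    · rw [if_neg h', f4.1 (by omega)]
  · rw [if_neg (by omega), if_neg h]
    by_cases h' : s + 1 + 1 ≤ t
    · rw [if_pos h', Nat.sub_zero]
    · rw [if_neg h']
      have := f3.1 (by omega)
      simp [xel, this, f1, a3]

theorem hasValley_iff {t : ℕ} {α : ℕ → ℕ} (hF : IsFence t α) {s : ℕ} (hs : s < t)
    (ha : 2 ≤ α s) : HasValley t (s + 1) ↔ Elem t α (uElx t α (s + 1) 0) := by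
  obtain ⟨f1, f2, f3, f4⟩ := seg_facts hF hs
  rw [Elem, uElx_val hF hs (Nat.zero_le _), HasValley]
  split_ifs <;> omega

/-- which segment a covering relation lives in. -/
theorem seg_tri {α : ℕ → ℕ} (s r : ℕ) :
    r = s ∨ (r < s ∧ m α (r + 1) ≤ m α s) ∨ (s < r ∧ m α s + α s ≤ m α r) := by
  rcases lt_trichotomy r s with h | h | h
  · exact Or.inr (Or.inl ⟨h, m_mono α h⟩)
  · exact Or.inl h
  · refine Or.inr (Or.inr ⟨h, ?_⟩)
    rw [← m_succ]; exact m_mono α h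

theorem cov_up {t : ℕ} {α : ℕ → ℕ} (hF : IsFence t α) {s : ℕ} (hs : s < t)
    {k : ℕ} (hk0 : 1 ≤ k) (hk : k + 1 ≤ α s) (u : V t α) :
    Cov t α (uElx t α (s + 1) k) u ↔ u = uElx t α (s + 1) (k + 1) ∧ Elem t α u := by
  obtain ⟨f1, f2, f3, f4⟩ := seg_facts hF hs
  have a3 := m_succ α s
  have v1 := uElx_val hF hs (show k ≤ α s by omega)
  have v2 := uElx_val hF hs hk
  rw [if_neg (show ¬ (k + 1 = 0 ∧ s + 1 = t) by omega)] at v2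
  have z1 : m α s + α s - k + k = m α s + α s := Nat.sub_add_cancel (by omega)
  have z2 : m α s + α s - (k + 1) + (k + 1) = m α s + α s := Nat.sub_add_cancel (by omega)
  generalize m α s + α s - k = y1 at v1 z1
  generalize m α s + α s - (k + 1) = y2 at v2 z2
  have hu := u.2
  constructor
  · intro h
    refine ⟨?_, (cov_elem h).2⟩
    obtain ⟨r, hr, h1, h2, h3, h4, h5⟩ := h
    apply Fin.ext
    rcases seg_tri (α := α) s r with rfl | h | h <;> split_ifs at v1 v2 <;> omega
  · rintro ⟨rfl, h⟩
    rw [Elem] at h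
    refine ⟨s, hs, ?_⟩
    split_ifs at v1 v2 <;> omega

theorem cov_down {t : ℕ} {α : ℕ → ℕ} (hF : IsFence t α) {s : ℕ} (hs : s < t)
    {k : ℕ} (hk : k + 2 ≤ α s) (u : V t α) :
    Cov t α u (uElx t α (s + 1) (k + 1)) ↔ u = uElx t α (s + 1) k ∧ Elem t α u := by
  obtain ⟨f1, f2, f3, f4⟩ := seg_facts hF hs
  have a3 := m_succ α s
  have v1 := uElx_val hF hs (show k ≤ α s by omega)
  have v2 := uElx_val hF hs (show k + 1 ≤ α s by omega)
  rw [if_neg (show ¬ (k + 1 = 0 ∧ s + 1 = t) by omega)] at v2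
  have z1 : m α s + α s - k + k = m α s + α s := Nat.sub_add_cancel (by omega)
  have z2 : m α s + α s - (k + 1) + (k + 1) = m α s + α s := Nat.sub_add_cancel (by omega)
  generalize m α s + α s - k = y1 at v1 z1
  generalize m α s + α s - (k + 1) = y2 at v2 z2
  have hu := u.2
  constructor
  · intro h
    refine ⟨?_, (cov_elem h).1⟩
    obtain ⟨r, hr, h1, h2, h3, h4, h5⟩ := h
    apply Fin.ext
    rcases seg_tri (α := α) s r with rfl | h | h <;> split_ifs at v1 v2 <;> omega
  · rintro ⟨rfl, h⟩
    rw [Elem] at h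
    refine ⟨s, hs, ?_⟩
    split_ifs at v1 v2 <;> omega

theorem cov_peak {t : ℕ} {α : ℕ → ℕ} (hF : IsFence t α) {s : ℕ} (hs : s < t)
    (ha : 2 ≤ α s) (u : V t α) : ¬ Cov t α (uElx t α (s + 1) (α s)) u := by
  obtain ⟨f1, f2, f3, f4⟩ := seg_facts hF hs
  have a3 := m_succ α s
  have v1 := uElx_val hF hs (le_refl (α s))
  have hu := u.2
  rintro ⟨r, hr, h1, h2, h3, h4, h5⟩
  have hp := hF.2.1
  by_cases hpar : s % 2 = 0
  · by_cases hst : s + 1 = t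
    · rw [if_pos hpar, if_pos ⟨rfl, hst⟩] at v1
      omega
    · have b := hp (s + 1) (by omega)
      have := seg_tri (α := α) (s + 1) r
      have := seg_tri (α := α) s r
      rw [if_pos hpar, if_neg (by omega)] at v1
      omega
  · have b := hp (s - 1) (by omega)
    have b2 := m_succ α (s - 1)
    rw [show s - 1 + 1 = s by omega] at b2
    have := seg_tri (α := α) (s - 1) r
    have := seg_tri (α := α) s r
    rw [if_neg hpar, if_neg (by omega)] at v1
    omega

theorem uElx_inj {t : ℕ} {α : ℕ → ℕ} (hF : IsFence t α) {s : ℕ} (hs : s < t)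
    {k l : ℕ} (hk0 : 1 ≤ k) (hk : k + 1 ≤ α s) (hl0 : 1 ≤ l) (hl : l ≤ α s)
    (h : uElx t α (s + 1) k = uElx t α (s + 1) l) : k = l := by
  have v1 := uElx_val hF hs (show k ≤ α s by omega)
  have v2 := uElx_val hF hs hl
  rw [h] at v1
  split_ifs at v1 v2 <;> omega

theorem uElx_elem {t : ℕ} {α : ℕ → ℕ} (hF : IsFence t α) {s : ℕ} (hs : s < t)
    {k : ℕ} (hk0 : 1 ≤ k) (hk : k + 1 ≤ α s) : Elem t α (uElx t α (s + 1) k) := by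
  have v1 := uElx_val hF hs (show k ≤ α s by omega)
  rw [Elem]
  split_ifs at v1 <;> omega

theorem le_chain {t : ℕ} {α : ℕ → ℕ} (hF : IsFence t α) {s : ℕ} (hs : s < t)
    {a b : ℕ} (ha0 : 1 ≤ a) (hab : a ≤ b) (hb : b + 1 ≤ α s) :
    Le t α (uElx t α (s + 1) a) (uElx t α (s + 1) b) := by
  induction b, hab using Nat.le_induction with
  | base => exact Relation.ReflTransGen.refl
  | succ b hab ih =>
    refine (ih (by omega)).tail ?_
    exact (cov_up hF hs (by omega) (by omega) _).2 ⟨rfl, uElx_elem hF hs (by omega) hb⟩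

theorem le_up {t : ℕ} {α : ℕ → ℕ} (hF : IsFence t α) {s : ℕ} (hs : s < t)
    (h2 : 2 ≤ α s) {a : ℕ} (ha0 : 1 ≤ a) (ha : a ≤ α s) {u : V t α}
    (h : Le t α (uElx t α (s + 1) a) u) :
    ∃ k, a ≤ k ∧ k ≤ α s ∧ u = uElx t α (s + 1) k := by
  induction h with
  | refl => exact ⟨a, le_rfl, ha, rfl⟩
  | tail _ hc ih =>
    obtain ⟨k, hk1, hk2, rfl⟩ := ih
    rcases Nat.lt_or_ge k (α s) with h | h
    · exact ⟨k + 1, by omega, h, ((cov_up hF hs (by omega) h _).1 hc).1⟩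
    · have : k = α s := by omega
      subst this
      exact absurd hc (cov_peak hF hs h2 _)

theorem interval_iff {t : ℕ} {α : ℕ → ℕ} (hF : IsFence t α) {s : ℕ} (hs : s < t)
    (h2 : 2 ≤ α s) {a b : ℕ} (ha0 : 1 ≤ a) (ha : a ≤ α s) (hb0 : 1 ≤ b) (hb : b + 1 ≤ α s)
    (u : V t α) :
    (Elem t α u ∧ Le t α (uElx t α (s + 1) a) u ∧ Le t α u (uElx t α (s + 1) b)) ↔
      ∃ k, a ≤ k ∧ k ≤ b ∧ uElx t α (s + 1) k = u := by
  constructor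
  · rintro ⟨-, hl, hr⟩
    obtain ⟨k, hk1, hk2, rfl⟩ := le_up hF hs h2 ha0 ha hl
    obtain ⟨l, hl1, hl2, he⟩ := le_up hF hs h2 (by omega) hk2 hr
    have := uElx_inj hF hs hb0 hb (by omega) hl2 he
    exact ⟨k, hk1, by omega, rfl⟩
  · rintro ⟨k, hk1, hk2, rfl⟩
    exact ⟨uElx_elem hF hs (by omega) (by omega), le_chain hF hs ha0 hk1 (by omega),
      le_chain hF hs (by omega) hk2 hb⟩

theorem injOn_chain {t : ℕ} {α : ℕ → ℕ} (hF : IsFence t α) {s : ℕ} (hs : s < t)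
    {a b : ℕ} (ha0 : 1 ≤ a) (hb : b + 1 ≤ α s) :
    Set.InjOn (fun k => uElx t α (s + 1) k) (Finset.Icc a b : Finset ℕ) := by
  intro k hk l hl h
  simp only [Finset.coe_Icc, Set.mem_Icc] at hk hl
  exact uElx_inj hF hs (by omega) (by omega) (by omega) (by omega) h

theorem icard_chain {t : ℕ} {α : ℕ → ℕ} (hF : IsFence t α) {s : ℕ} (hs : s < t)
    (h2 : 2 ≤ α s) {a b : ℕ} (ha0 : 1 ≤ a) (ha : a ≤ α s) (hb0 : 1 ≤ b) (hb : b + 1 ≤ α s) :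
    icard t α (uElx t α (s + 1) a) (uElx t α (s + 1) b) = b + 1 - a := by
  have : {r : V t α | Elem t α r ∧ Le t α (uElx t α (s + 1) a) r ∧
      Le t α r (uElx t α (s + 1) b)} =
      (fun k => uElx t α (s + 1) k) '' (Finset.Icc a b : Finset ℕ) := by
    ext u
    rw [Set.mem_ofPred_eq, interval_iff hF hs h2 ha0 ha hb0 hb]
    simp [and_assoc]
  rw [icard, this, Set.InjOn.ncard_image (injOn_chain hF hs ha0 hb), Set.ncard_coe_finset,
    Nat.card_Icc]

/-- extended indicator along the chain. -/
noncomputable def hval (t : ℕ) (α : ℕ → ℕ) (s : ℕ) (I : J t α) (k : ℕ) : ℝ :=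
  chiHat t α (uElx t α (s + 1) k) I + (if k = 0 ∧ ¬ HasValley t (s + 1) then 1 else 0)

theorem Tg_chain {t : ℕ} {α : ℕ → ℕ} (hF : IsFence t α) {s : ℕ} (hs : s < t)
    (h2 : 2 ≤ α s) (I : J t α) {k : ℕ} (hk : k + 2 ≤ α s) :
    Tg t α (uElx t α (s + 1) (k + 1)) I =
      hval t α s I k - 2 * hval t α s I (k + 1) + hval t α s I (k + 2) := by
  have e1 := uElx_elem hF hs (show 1 ≤ k + 1 by omega) (show k + 1 + 1 ≤ α s by omega)
  have hmin : MinOut t α I.1 (uElx t α (s + 1) (k + 1)) ↔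
      uElx t α (s + 1) (k + 1) ∉ I.1 ∧
        (Elem t α (uElx t α (s + 1) k) → uElx t α (s + 1) k ∈ I.1) := by
    rw [minOut_iff]
    simp only [cov_down hF hs hk]
    constructor
    · rintro ⟨_, h, h'⟩; exact ⟨h, fun he => h' _ ⟨rfl, he⟩⟩
    · rintro ⟨h, h'⟩; exact ⟨e1, h, by rintro q ⟨rfl, he⟩; exact h' he⟩
  have hmax : MaxIn t α I.1 (uElx t α (s + 1) (k + 1)) ↔
      uElx t α (s + 1) (k + 1) ∈ I.1 ∧ uElx t α (s + 1) (k + 2) ∉ I.1 := by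
    rw [maxIn_iff]
    simp only [cov_up hF hs (show 1 ≤ k + 1 by omega) (show k + 1 + 1 ≤ α s by omega)]
    constructor
    · rintro ⟨h, h'⟩; exact ⟨h, fun hI => h' _ ⟨rfl, I.2.1 _ hI⟩ hI⟩
    · rintro ⟨h, h'⟩; exact ⟨h, by rintro q ⟨rfl, he⟩; exact h'⟩
  have hd1 : uElx t α (s + 1) (k + 2) ∈ I.1 → uElx t α (s + 1) (k + 1) ∈ I.1 := fun h =>
    I.2.2 _ _ (Relation.ReflTransGen.single ((cov_up hF hs (show 1 ≤ k + 1 by omega)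
      (show k + 1 + 1 ≤ α s by omega) _).2 ⟨rfl, I.2.1 _ h⟩)) h
  have hd2 : uElx t α (s + 1) (k + 1) ∈ I.1 → Elem t α (uElx t α (s + 1) k) →
      uElx t α (s + 1) k ∈ I.1 := fun h he =>
    I.2.2 _ _ (Relation.ReflTransGen.single ((cov_down hF hs hk _).2 ⟨rfl, he⟩)) h
  have hel : (k = 0 ∧ ¬ HasValley t (s + 1)) ↔ ¬ Elem t α (uElx t α (s + 1) k) := by
    rw [hasValley_iff hF hs h2]
    constructor
    · rintro ⟨rfl, h⟩; exact h
    · intro h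
      have : k = 0 := by
        by_contra h0
        exact h (uElx_elem hF hs (by omega) (by omega))
      subst this
      exact ⟨rfl, h⟩
  have hne : uElx t α (s + 1) k ∈ I.1 → Elem t α (uElx t α (s + 1) k) := I.2.1 _
  simp only [Tg, hval, chiHat, hmin, hmax, hel]
  by_cases c0 : uElx t α (s + 1) k ∈ I.1 <;> by_cases c1 : uElx t α (s + 1) (k + 1) ∈ I.1 <;>
    by_cases c2 : uElx t α (s + 1) (k + 2) ∈ I.1 <;>
    by_cases c3 : Elem t α (uElx t α (s + 1) k) <;> simp_all <;> norm_num

theorem sum_low (h : ℕ → ℝ) (j : ℕ) :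
    ∑ k ∈ Finset.Icc 1 j, (k : ℝ) * (h (k - 1) - 2 * h k + h (k + 1)) =
      h 0 - (j + 1) * h j + j * h (j + 1) := by
  induction j with
  | zero => simp
  | succ j ih =>
    rw [Finset.sum_Icc_succ_top (by omega), ih]
    simp only [Nat.add_sub_cancel]
    push_cast
    ring_nf

theorem sum_high (h : ℕ → ℝ) (j d : ℕ) :
    ∑ k ∈ Finset.Icc (j + 1) (j + d), ((j + d + 1 : ℕ) - k : ℝ) *
        (h (k - 1) - 2 * h k + h (k + 1)) =
      d * h j - (d + 1) * h (j + 1) + h (j + d + 1) := by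
  induction d generalizing j with
  | zero => simp
  | succ d ih =>
    rw [← Finset.add_sum_Ioc_eq_sum_Icc (by omega), ← Finset.Icc_add_one_left_eq_Ioc]
    have := ih (j + 1)
    rw [show j + 1 + d = j + (d + 1) by omega] at this
    rw [this]
    simp only [Nat.add_sub_cancel]
    push_cast
    ring_nf

/-- Theorem `oic basis equiv const`.
For `i ∈ [t]` with `α_i ≥ 2`, `j ∈ [β_i]`, with `p` the peak and `v` the valley of `S_i`
(zero statistic if nonexistent):
`α_i·χ̂_{(i,j)} − j·χ̂_p − (α_i−j)·χ̂_v = 𝟙(S_i has no valley)·(α_i−j)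
  − (α_i−j)·Σ_{s_{(i,1)} ⊴ u ⊴ s_{(i,j)}} #[s_{(i,1)},u]·T_u
  − j·Σ_{s_{(i,j)} ◁ u ⊴ s_{(i,β_i)}} #[u,s_{(i,β_i)}]·T_u`. -/
theorem statement5 (t : ℕ) (α : ℕ → ℕ) (hF : IsFence t α)
    (i : ℕ) (hi1 : 1 ≤ i) (hit : i ≤ t) (hαi : 2 ≤ α (i - 1))
    (j : ℕ) (hj1 : 1 ≤ j) (hj2 : j ≤ α (i - 1) - 1) :
    ∀ I : J t α,
      (α (i - 1) : ℝ) * chiHat t α (uElx t α i j) I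
          - (j : ℝ) * chiHat t α (peakx t α i) I
          - ((α (i - 1) : ℝ) - (j : ℝ)) * chiHat t α (valleyx t α i) I
        = (if HasValley t i then 0 else 1) * ((α (i - 1) : ℝ) - (j : ℝ))
          - ((α (i - 1) : ℝ) - (j : ℝ)) *
            (∑ u ∈ Finset.univ.filter (fun u : V t α =>
                Elem t α u ∧ Le t α (uElx t α i 1) u ∧ Le t α u (uElx t α i j)),
              (icard t α (uElx t α i 1) u : ℝ) * Tg t α u I)
          - (j : ℝ) *
            (∑ u ∈ Finset.univ.filter (fun u : V t α =>
                Elem t α u ∧ Le t α (uElx t α i j) u ∧ u ≠ uElx t α i j ∧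
                  Le t α u (uElx t α i (α (i - 1) - 1))),
              (icard t α u (uElx t α i (α (i - 1) - 1)) : ℝ) * Tg t α u I) := by
  intro I
  obtain ⟨s, rfl⟩ : ∃ s, i = s + 1 := ⟨i - 1, by omega⟩
  simp only [Nat.add_sub_cancel] at hαi hj2 ⊢
  have hs : s < t := by omega
  obtain ⟨d, hd⟩ : ∃ d, α s = j + d + 1 := ⟨α s - 1 - j, by omega⟩
  have hb : α s - 1 = j + d := by omega
  rw [peakx_eq hF hs, valleyx_eq hF hs, hb]
  have hT : ∀ k, 1 ≤ k → k + 1 ≤ α s → Tg t α (uElx t α (s + 1) k) I =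
      hval t α s I (k - 1) - 2 * hval t α s I k + hval t α s I (k + 1) := by
    intro k hk1 hk2
    obtain ⟨l, rfl⟩ : ∃ l, k = l + 1 := ⟨k - 1, by omega⟩
    exact Tg_chain hF hs hαi I (by omega)
  have e1 : Finset.univ.filter (fun u : V t α =>
      Elem t α u ∧ Le t α (uElx t α (s + 1) 1) u ∧ Le t α u (uElx t α (s + 1) j)) =
      (Finset.Icc 1 j).image (fun k => uElx t α (s + 1) k) := by
    ext u
    simp only [Finset.mem_filter, Finset.mem_univ, true_and, Finset.mem_image, Finset.mem_Icc]
    rw [interval_iff hF hs hαi le_rfl (by omega) hj1 (by omega)]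
    simp [and_assoc]
  have e2 : Finset.univ.filter (fun u : V t α =>
      Elem t α u ∧ Le t α (uElx t α (s + 1) j) u ∧ u ≠ uElx t α (s + 1) j ∧
        Le t α u (uElx t α (s + 1) (j + d))) =
      (Finset.Icc (j + 1) (j + d)).image (fun k => uElx t α (s + 1) k) := by
    ext u
    simp only [Finset.mem_filter, Finset.mem_univ, true_and, Finset.mem_image, Finset.mem_Icc]
    have key := interval_iff hF hs hαi hj1 (by omega) (show 1 ≤ j + d by omega) (by omega) u
    constructor
    · rintro ⟨h1, h2, h3, h4⟩
      obtain ⟨k, hk1, hk2, rfl⟩ := key.1 ⟨h1, h2, h4⟩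
      refine ⟨k, ⟨?_, hk2⟩, rfl⟩
      rcases Nat.eq_or_lt_of_le hk1 with h | h
      · subst h; exact absurd rfl h3
      · exact h
    · rintro ⟨k, ⟨hk1, hk2⟩, rfl⟩
      obtain ⟨h1, h2, h4⟩ := key.2 ⟨k, by omega, hk2, rfl⟩
      refine ⟨h1, h2, fun h => ?_, h4⟩
      have := uElx_inj hF hs (by omega) (by omega) (by omega) (by omega) h
      omega
  rw [e1, e2, Finset.sum_image (injOn_chain hF hs le_rfl (by omega)),
    Finset.sum_image (injOn_chain hF hs (by omega) (by omega))]
  have s1 : ∑ k ∈ Finset.Icc 1 j, (icard t α (uElx t α (s + 1) 1) (uElx t α (s + 1) k) : ℝ) *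
      Tg t α (uElx t α (s + 1) k) I =
      hval t α s I 0 - (j + 1) * hval t α s I j + j * hval t α s I (j + 1) := by
    rw [← sum_low]
    refine Finset.sum_congr rfl fun k hk => ?_
    rw [Finset.mem_Icc] at hk
    rw [hT k hk.1 (by omega), icard_chain hF hs hαi le_rfl (by omega) hk.1 (by omega),
      Nat.add_sub_cancel]
  have s2 : ∑ k ∈ Finset.Icc (j + 1) (j + d),
      (icard t α (uElx t α (s + 1) k) (uElx t α (s + 1) (j + d)) : ℝ) *
      Tg t α (uElx t α (s + 1) k) I =
      d * hval t α s I j - (d + 1) * hval t α s I (j + 1) + hval t α s I (j + d + 1) := by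
    rw [← sum_high]
    refine Finset.sum_congr rfl fun k hk => ?_
    rw [Finset.mem_Icc] at hk
    rw [hT k (by omega) (by omega), icard_chain hF hs hαi (by omega) (by omega) (by omega)
      (by omega), Nat.cast_sub (by omega)]
  rw [s1, s2]
  have z0 : chiHat t α (uElx t α (s + 1) 0) I =
      hval t α s I 0 - (if HasValley t (s + 1) then 0 else 1) := by
    by_cases h : HasValley t (s + 1) <;> simp [hval, h]
  have z1 : ∀ k, 1 ≤ k → chiHat t α (uElx t α (s + 1) k) I = hval t α s I k := by
    intro k hk
    simp [hval, show k ≠ 0 by omega]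
  rw [z0, z1 j hj1, z1 (α s) (by omega), hd]
  push_cast
  ring

end Fence
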